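/- arXiv:2602.23764 — 3 statements merged into one kernel-verified Lean document; each statement's English description precedes it below -/
import Mathlib

section
/- Let p, q ∈ ℕ, let a_1,…,a_p > 0, b_1,…,b_q > 0, A_1,…,A_p > 0, B_1,…,B_q > 0 be real numbers, and suppose Υ = Σ_{r=1}^q B_r − Σ_{l=1}^p A_l > −1. Then for every z ∈ ℂ the Fox–Wright series Σ_{k=0}^∞ c_k z^k converges absolutely (the family (c_k z^k)_{k∈ℕ} is summable). -/
open Filter Topology

theorem Real.log_Gamma_add_one {x : ℝ} (hx : 0 < x) :
    Real.log (Real.Gamma (x + 1)) = Real.log (Real.Gamma x) + Real.log x := by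
  rw [Real.Gamma_add_one hx.ne', Real.log_mul hx.ne' (Real.Gamma_pos_of_pos hx).ne', add_comm]

theorem Real.log_Gamma_add_sub_le {x h : ℝ} (hx : 0 < x) (hh : 0 < h) :
    Real.log (Real.Gamma (x + h)) - Real.log (Real.Gamma x) ≤ h * Real.log (x + h) := by
  have hslope := Real.convexOn_log_Gamma.slope_mono_adjacent (x := x) (y := x + h)
    (z := x + h + 1) hx (by simp only [Set.mem_Ioi]; linarith) (by linarith) (by linarith)
  simp only [Function.comp_apply, add_sub_cancel_left, div_one] at hslope
  rw [Real.log_Gamma_add_one (by linarith : 0 < x + h), div_le_iff₀ hh] at hslope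
  linarith

theorem Real.mul_log_le_log_Gamma_add_sub {x h : ℝ} (hx : 0 < x) (hh : 0 < h) :
    h * Real.log x ≤ Real.log (Real.Gamma (x + 1 + h)) - Real.log (Real.Gamma (x + 1)) := by
  have hslope := Real.convexOn_log_Gamma.slope_mono_adjacent (x := x) (y := x + 1)
    (z := x + 1 + h) hx (by simp only [Set.mem_Ioi]; linarith) (by linarith) (by linarith)
  simp only [Function.comp_apply, add_sub_cancel_left, div_one] at hslope
  rw [Real.log_Gamma_add_one hx, add_sub_cancel_left, le_div_iff₀ hh] at hslope
  rw [Real.log_Gamma_add_one hx]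
  linarith

theorem Real.tendsto_log_add_mul_sub_log (s : ℝ) {A : ℝ} (hA : 0 < A) :
    Tendsto (fun k : ℕ => Real.log (s + k * A) - Real.log k) atTop (𝓝 (Real.log A)) := by
  have hdiv : Tendsto (fun k : ℕ => s / (k : ℝ) + A) atTop (𝓝 A) := by
    simpa using (tendsto_const_div_atTop_nhds_zero_nat s).add_const A
  have hpos : ∀ᶠ k : ℕ in atTop, 0 < s / (k : ℝ) + A := hdiv.eventually (lt_mem_nhds hA)
  refine (hdiv.log hA.ne').congr' ?_
  filter_upwards [hpos, eventually_gt_atTop 0] with k hk hk0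
  have hk' : (0 : ℝ) < k := by exact_mod_cast hk0
  have hmul : s + k * A = (s / k + A) * k := by field_simp
  rw [hmul, Real.log_mul hk.ne' hk'.ne', add_sub_cancel_right]

/-- The increments of `k ↦ log Γ(a + k A)` are `A log k + A log A + o(1)`. -/
theorem Real.tendsto_log_Gamma_increment (a : ℝ) {A : ℝ} (hA : 0 < A) :
    Tendsto (fun k : ℕ => Real.log (Real.Gamma (a + ((k + 1 : ℕ) : ℝ) * A))
      - Real.log (Real.Gamma (a + k * A)) - A * Real.log k) atTop (𝓝 (A * Real.log A)) := by
  have hlarge : Tendsto (fun k : ℕ => a - 1 + (k : ℝ) * A) atTop atTop :=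
    tendsto_atTop_add_const_left _ _ (tendsto_natCast_atTop_atTop.atTop_mul_const hA)
  refine tendsto_of_tendsto_of_tendsto_of_le_of_le'
    ((Real.tendsto_log_add_mul_sub_log (a - 1) hA).const_mul A)
    ((Real.tendsto_log_add_mul_sub_log (a + A) hA).const_mul A) ?_ ?_
  · filter_upwards [hlarge.eventually_gt_atTop 0] with k hk
    have hle := Real.mul_log_le_log_Gamma_add_sub hk hA
    rw [show a - 1 + (k : ℝ) * A + 1 + A = a + ((k + 1 : ℕ) : ℝ) * A by push_cast; ring,
      show a - 1 + (k : ℝ) * A + 1 = a + k * A by ring] at hle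
    linarith
  · filter_upwards [hlarge.eventually_gt_atTop 0] with k hk
    have hle := Real.log_Gamma_add_sub_le (x := a + k * A) (by linarith) hA
    rw [show a + (k : ℝ) * A + A = a + ((k + 1 : ℕ) : ℝ) * A by push_cast; ring] at hle
    rw [show a + A + (k : ℝ) * A = a + ((k + 1 : ℕ) : ℝ) * A by push_cast; ring]
    linarith

/-- If Υ = Σ B_r − Σ A_l > −1, the Fox–Wright series converges
absolutely (is summable) at every z ∈ ℂ. -/
theorem foxWright_summable_of_upsilon_gt_neg_one
    (p q : ℕ) (a A : Fin p → ℝ) (b B : Fin q → ℝ)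
    (ha : ∀ l, 0 < a l) (hb : ∀ r, 0 < b r)
    (hA : ∀ l, 0 < A l) (hB : ∀ r, 0 < B r)
    (c : ℕ → ℝ)
    (hc : ∀ k : ℕ, c k =
      (∏ l, Real.Gamma (a l + (k : ℝ) * A l)) /
        ((∏ r, Real.Gamma (b r + (k : ℝ) * B r)) * (Nat.factorial k : ℝ)))
    (hΥ : -1 < (∑ r, B r) - (∑ l, A l)) :
    ∀ z : ℂ, Summable fun k : ℕ => (c k : ℂ) * z ^ k := by
  intro z
  have hΓa (k : ℕ) (l : Fin p) : 0 < Real.Gamma (a l + k * A l) :=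
    Real.Gamma_pos_of_pos (add_pos_of_pos_of_nonneg (ha l) (mul_nonneg k.cast_nonneg (hA l).le))
  have hΓb (k : ℕ) (r : Fin q) : 0 < Real.Gamma (b r + k * B r) :=
    Real.Gamma_pos_of_pos (add_pos_of_pos_of_nonneg (hb r) (mul_nonneg k.cast_nonneg (hB r).le))
  have hpos (k : ℕ) : 0 < c k := by
    rw [hc]
    exact div_pos (Finset.prod_pos fun l _ => hΓa k l)
      (mul_pos (Finset.prod_pos fun r _ => hΓb k r) (by positivity))
  have hlog (k : ℕ) : Real.log (c k) = ∑ l, Real.log (Real.Gamma (a l + k * A l))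
      - (∑ r, Real.log (Real.Gamma (b r + k * B r)) + Real.log (Real.Gamma (1 + k * 1))) := by
    have ha' : ∏ l, Real.Gamma (a l + k * A l) ≠ 0 :=
      Finset.prod_ne_zero_iff.2 fun l _ => (hΓa k l).ne'
    have hb' : ∏ r, Real.Gamma (b r + k * B r) ≠ 0 :=
      Finset.prod_ne_zero_iff.2 fun r _ => (hΓb k r).ne'
    have hk : (Nat.factorial k : ℝ) ≠ 0 := by positivity
    rw [hc, Real.log_div ha' (mul_ne_zero hb' hk), Real.log_mul hb' hk,
      Real.log_prod fun l _ => (hΓa k l).ne', Real.log_prod fun r _ => (hΓb k r).ne',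
      mul_one, add_comm 1 (k : ℝ), Real.Gamma_nat_eq_factorial]
  have hlim := ((tendsto_finsetSum Finset.univ fun l _ =>
      Real.tendsto_log_Gamma_increment (a l) (hA l)).sub
    ((tendsto_finsetSum Finset.univ fun r _ =>
      Real.tendsto_log_Gamma_increment (b r) (hB r)).add
      (Real.tendsto_log_Gamma_increment 1 one_pos)))
  have hmain : Tendsto (fun k : ℕ => (∑ l, A l - ∑ r, B r - 1) * Real.log k) atTop atBot :=
    (Real.tendsto_log_atTop.comp tendsto_natCast_atTop_atTop).const_mul_atTop_of_neg
      (by linarith)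
  have hincr : Tendsto (fun k : ℕ => Real.log (c (k + 1)) - Real.log (c k)) atTop atBot := by
    refine (hlim.add_atBot hmain).congr fun k => ?_
    rw [hlog, hlog]
    simp only [Finset.sum_sub_distrib, ← Finset.sum_mul]
    ring
  have hratio := (Real.tendsto_exp_atBot.comp hincr).mul_const ‖z‖
  rw [zero_mul] at hratio
  refine summable_of_ratio_norm_eventually_le (r := 1 / 2) (by norm_num) ?_
  filter_upwards [hratio.eventually (ge_mem_nhds (by norm_num : (0 : ℝ) < 1 / 2))] with k hk
  simp only [Function.comp_apply, Real.exp_sub, Real.exp_log (hpos _)] at hk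
  have hck := hpos k
  simp only [norm_mul, norm_pow, Complex.norm_real, Real.norm_of_nonneg (hpos _).le]
  calc c (k + 1) * ‖z‖ ^ (k + 1) = c (k + 1) / c k * ‖z‖ * (c k * ‖z‖ ^ k) := by
        rw [pow_succ]
        field_simp
    _ ≤ 1 / 2 * (c k * ‖z‖ ^ k) := by gcongr
end

section
/- Let p, q ∈ ℕ, let a_1,…,a_p > 0, b_1,…,b_q > 0, A_1,…,A_p > 0, B_1,…,B_q > 0 be real numbers, and suppose Υ = Σ_{r=1}^q B_r − Σ_{l=1}^p A_l < −1. Then for every z ∈ ℂ with z ≠ 0 the family (c_k z^k)_{k∈ℕ} is not summable; that is, the radius of convergence of the power series with coefficients c_k equals 0. -/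
open scoped BigOperators

open Filter Topology

theorem log_Gamma_le_mul_log {x : ℝ} (hx : 2 ≤ x) :
    Real.log (Real.Gamma x) ≤ x * Real.log x := by
  have hx0 : 0 ≤ x := by linarith
  have hn2 : (2 : ℕ) ≤ ⌊x⌋₊ := Nat.le_floor (by exact_mod_cast hx)
  have hn2' : (2 : ℝ) ≤ (⌊x⌋₊ : ℝ) := by exact_mod_cast hn2
  have hnx : (⌊x⌋₊ : ℝ) ≤ x := Nat.floor_le hx0
  have hle : Real.Gamma x ≤ (⌊x⌋₊ : ℝ) ^ ⌊x⌋₊ := by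
    calc Real.Gamma x ≤ Real.Gamma (⌊x⌋₊ + 1) :=
          Real.Gamma_strictMonoOn_Ici.monotoneOn (Set.mem_Ici.2 hx)
            (Set.mem_Ici.2 (by linarith)) (Nat.lt_floor_add_one x).le
      _ = (Nat.factorial ⌊x⌋₊ : ℝ) := Real.Gamma_nat_eq_factorial _
      _ ≤ (⌊x⌋₊ : ℝ) ^ ⌊x⌋₊ := by exact_mod_cast Nat.factorial_le_pow _
  calc Real.log (Real.Gamma x) ≤ Real.log ((⌊x⌋₊ : ℝ) ^ ⌊x⌋₊) :=
        Real.log_le_log (Real.Gamma_pos_of_pos (by linarith)) hle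
    _ = ⌊x⌋₊ * Real.log ⌊x⌋₊ := Real.log_pow _ _
    _ ≤ x * Real.log x := by
        have := Real.log_le_log (by linarith) hnx
        have := Real.log_nonneg (show (1 : ℝ) ≤ (⌊x⌋₊ : ℝ) by linarith)
        gcongr

theorem sub_two_mul_log_sub_le_log_Gamma {x : ℝ} (hx : 3 ≤ x) :
    (x - 2) * (Real.log x - Real.log 2) - x ≤ Real.log (Real.Gamma x) := by
  have hx0 : 0 ≤ x := by linarith
  have hn2 : (3 : ℕ) ≤ ⌊x⌋₊ := Nat.le_floor (by exact_mod_cast hx)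
  have hn2' : (3 : ℝ) ≤ (⌊x⌋₊ : ℝ) := by exact_mod_cast hn2
  have hnx : (⌊x⌋₊ : ℝ) ≤ x := Nat.floor_le hx0
  have hxn : x < (⌊x⌋₊ : ℝ) + 1 := Nat.lt_floor_add_one x
  have hn0 : (⌊x⌋₊ : ℝ) ≠ 0 := by linarith
  have hpos : 0 < Real.Gamma (⌊x⌋₊ : ℝ) := Real.Gamma_pos_of_pos (by linarith)
  have hmono : Real.log (Real.Gamma ⌊x⌋₊) ≤ Real.log (Real.Gamma x) :=
    Real.log_le_log hpos (Real.Gamma_strictMonoOn_Ici.monotoneOn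
      (Set.mem_Ici.2 (by linarith)) (Set.mem_Ici.2 (by linarith)) hnx)
  have hfac : Real.log (Nat.factorial ⌊x⌋₊ : ℝ)
      = Real.log ⌊x⌋₊ + Real.log (Real.Gamma ⌊x⌋₊) := by
    rw [← Real.Gamma_nat_eq_factorial, Real.Gamma_add_one hn0, Real.log_mul hn0 hpos.ne']
  have hst := Stirling.le_log_factorial_stirling (n := ⌊x⌋₊) (by omega)
  have h1 : 0 ≤ Real.log (⌊x⌋₊ : ℝ) := Real.log_nonneg (by linarith)
  have h2 : 0 ≤ Real.log (2 * Real.pi) := Real.log_nonneg (by linarith [Real.pi_gt_three])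
  have h3 : Real.log x - Real.log 2 ≤ Real.log (⌊x⌋₊ : ℝ) := by
    rw [← Real.log_div (by linarith) (by norm_num)]
    exact Real.log_le_log (by linarith) (by linarith)
  have h4 : (x - 2) * (Real.log x - Real.log 2) ≤ ((⌊x⌋₊ : ℝ) - 1) * Real.log ⌊x⌋₊ :=
    (mul_le_mul_of_nonneg_left h3 (by linarith)).trans
      (mul_le_mul_of_nonneg_right (by linarith) h1)
  linarith

theorem tendsto_log_Gamma_div_mul_log_atTop :
    Tendsto (fun x : ℝ => Real.log (Real.Gamma x) / (x * Real.log x)) atTop (𝓝 1) := by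
  have hlow : Tendsto (fun x : ℝ =>
      (1 - 2 / x) * (1 - Real.log 2 / Real.log x) - 1 / Real.log x) atTop (𝓝 1) := by
    have h1 : Tendsto (fun x : ℝ => 2 / x) atTop (𝓝 0) := tendsto_id.const_div_atTop 2
    have h2 : Tendsto (fun x : ℝ => Real.log 2 / Real.log x) atTop (𝓝 0) :=
      Real.tendsto_log_atTop.const_div_atTop _
    have h3 : Tendsto (fun x : ℝ => 1 / Real.log x) atTop (𝓝 0) :=
      Real.tendsto_log_atTop.const_div_atTop _
    simpa using ((h1.const_sub 1).mul (h2.const_sub 1)).sub h3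
  refine tendsto_of_tendsto_of_tendsto_of_le_of_le' hlow tendsto_const_nhds ?_ ?_
  · filter_upwards [eventually_ge_atTop (3 : ℝ)] with x hx
    have hl : 0 < Real.log x := Real.log_pos (by linarith)
    have hx0 : 0 < x := by linarith
    rw [le_div_iff₀ (by positivity)]
    refine le_of_eq_of_le ?_ (sub_two_mul_log_sub_le_log_Gamma hx)
    field_simp
  · filter_upwards [eventually_ge_atTop (3 : ℝ)] with x hx
    have hl : 0 < Real.log x := Real.log_pos (by linarith)
    have hx0 : 0 < x := by linarith
    rw [div_le_one (by positivity)]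
    exact log_Gamma_le_mul_log (by linarith)

/-- The logarithm of `Γ (a + k A)` grows like `A k log k`. -/
theorem tendsto_log_Gamma_add_mul_div (a : ℝ) {A : ℝ} (hA : 0 < A) :
    Tendsto (fun k : ℕ => Real.log (Real.Gamma (a + k * A)) / (k * Real.log k))
      atTop (𝓝 A) := by
  have hk : Tendsto (fun k : ℕ => (k : ℝ)) atTop atTop := tendsto_natCast_atTop_atTop
  have hlogk : Tendsto (fun k : ℕ => Real.log k) atTop atTop := Real.tendsto_log_atTop.comp hk
  have hx : Tendsto (fun k : ℕ => a + (k : ℝ) * A) atTop atTop :=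
    tendsto_atTop_add_const_left _ _ (hk.atTop_mul_const hA)
  have h1 := tendsto_log_Gamma_div_mul_log_atTop.comp hx
  have h2 : Tendsto (fun k : ℕ => a / (k : ℝ) + A) atTop (𝓝 A) := by
    simpa using (hk.const_div_atTop a).add_const A
  have h3 : Tendsto (fun k : ℕ => 1 + Real.log (a / (k : ℝ) + A) / Real.log k)
      atTop (𝓝 1) := by
    simpa using ((h2.log hA.ne').div_atTop hlogk).const_add 1
  have h4 := (h1.mul h2).mul h3
  rw [one_mul, mul_one] at h4
  refine h4.congr' ?_
  filter_upwards [hk.eventually_gt_atTop 1, hx.eventually_gt_atTop 1] with k hk1 hx1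
  have hk0 : (k : ℝ) ≠ 0 := by linarith
  have hlk : Real.log (k : ℝ) ≠ 0 := (Real.log_pos hk1).ne'
  have hlx : Real.log (a + (k : ℝ) * A) ≠ 0 := (Real.log_pos hx1).ne'
  have hx0 : a + (k : ℝ) * A ≠ 0 := by linarith
  have e : a / (k : ℝ) + A = (a + k * A) / k := by field_simp
  rw [Function.comp_apply, e, Real.log_div hx0 hk0]
  field_simp
  ring

/-- If Υ = Σ B_r − Σ A_l < −1, the Fox–Wright series diverges for
every nonzero z ∈ ℂ (the family (c_k z^k) is not summable), i.e. the radius of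
convergence is 0. -/
theorem foxWright_divergent_of_upsilon_lt_neg_one
    (p q : ℕ) (a A : Fin p → ℝ) (b B : Fin q → ℝ)
    (ha : ∀ l, 0 < a l) (hb : ∀ r, 0 < b r)
    (hA : ∀ l, 0 < A l) (hB : ∀ r, 0 < B r)
    (c : ℕ → ℝ)
    (hc : ∀ k : ℕ, c k =
      (∏ l, Real.Gamma (a l + (k : ℝ) * A l)) /
        ((∏ r, Real.Gamma (b r + (k : ℝ) * B r)) * (Nat.factorial k : ℝ)))
    (hΥ : (∑ r, B r) - (∑ l, A l) < -1) :
    ∀ z : ℂ, z ≠ 0 → ¬ Summable fun k : ℕ => (c k : ℂ) * z ^ k := by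
  intro z hz hsum
  have hGa : ∀ (k : ℕ) l, 0 < Real.Gamma (a l + (k : ℝ) * A l) := fun k l =>
    Real.Gamma_pos_of_pos (add_pos_of_pos_of_nonneg (ha l) (by have := hA l; positivity))
  have hGb : ∀ (k : ℕ) r, 0 < Real.Gamma (b r + (k : ℝ) * B r) := fun k r =>
    Real.Gamma_pos_of_pos (add_pos_of_pos_of_nonneg (hb r) (by have := hB r; positivity))
  have hpa : ∀ k : ℕ, 0 < ∏ l, Real.Gamma (a l + (k : ℝ) * A l) := fun k =>
    Finset.prod_pos fun l _ => hGa k l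
  have hpb : ∀ k : ℕ, 0 < ∏ r, Real.Gamma (b r + (k : ℝ) * B r) := fun k =>
    Finset.prod_pos fun r _ => hGb k r
  have hf : ∀ k : ℕ, (0 : ℝ) < (Nat.factorial k : ℝ) := fun k => by positivity
  have hcpos : ∀ k, 0 < c k := fun k => by
    rw [hc]; exact div_pos (hpa k) (mul_pos (hpb k) (hf k))
  have hk : Tendsto (fun k : ℕ => (k : ℝ)) atTop atTop := tendsto_natCast_atTop_atTop
  have hlogk : Tendsto (fun k : ℕ => Real.log k) atTop atTop := Real.tendsto_log_atTop.comp hk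
  have hlogc : Tendsto (fun k : ℕ => Real.log (c k) / (k * Real.log k)) atTop
      (𝓝 ((∑ l, A l) - ((∑ r, B r) + 1))) := by
    have hTa := tendsto_finsetSum Finset.univ fun l _ =>
      tendsto_log_Gamma_add_mul_div (a l) (hA l)
    have hTb := tendsto_finsetSum Finset.univ fun r _ =>
      tendsto_log_Gamma_add_mul_div (b r) (hB r)
    refine (hTa.sub (hTb.add (tendsto_log_Gamma_add_mul_div 1 one_pos))).congr fun k => ?_
    rw [hc, Real.log_div (hpa k).ne' (mul_pos (hpb k) (hf k)).ne',
      Real.log_mul (hpb k).ne' (hf k).ne', Real.log_prod fun l _ => (hGa k l).ne',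
      Real.log_prod fun r _ => (hGb k r).ne', ← Finset.sum_div, ← Finset.sum_div,
      ← Real.Gamma_nat_eq_factorial, mul_one, add_comm (1 : ℝ) k]
    ring
  have hlim : 0 < (∑ l, A l) - ((∑ r, B r) + 1) := by linarith
  have hz' : 0 < ‖z‖ := norm_pos_iff.2 hz
  have hnorm : Tendsto (fun k : ℕ => Real.log ‖(c k : ℂ) * z ^ k‖) atTop atTop := by
    have hprod := hk.atTop_mul_atTop₀
      (tendsto_atTop_add_const_right _ (Real.log ‖z‖) (hlogc.pos_mul_atTop hlim hlogk))
    refine hprod.congr' ?_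
    filter_upwards [hk.eventually_gt_atTop 1] with k hk1
    have hk0 : (k : ℝ) ≠ 0 := by linarith
    have hlk : Real.log (k : ℝ) ≠ 0 := (Real.log_pos hk1).ne'
    rw [norm_mul, norm_pow, Complex.norm_real, Real.norm_of_nonneg (hcpos k).le,
      Real.log_mul (hcpos k).ne' (pow_pos hz' k).ne', Real.log_pow]
    field_simp
  have hzero : ∀ᶠ k in atTop, ‖(c k : ℂ) * z ^ k‖ < 1 :=
    hsum.tendsto_atTop_zero.norm.eventually_lt_const (by simp)
  obtain ⟨k, hk1, hk2⟩ := (hzero.and (hnorm.eventually_gt_atTop 0)).exists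
  exact absurd (Real.log_nonpos (norm_nonneg _) hk1.le) (not_le.2 hk2)
end

section
/- Let p, q ∈ ℕ and let a_1,…,a_p > 0, b_1,…,b_q > 0, A_1,…,A_p > 0, B_1,…,B_q > 0 be real numbers. Then lim_{k→∞} k^{Υ+1} · (c_k)^{1/k} = e^{Υ+1} / 𝒱, where c_k > 0 for all k. In particular, (c_k)^{1/k} → 0 if Υ > −1, (c_k)^{1/k} → 1/𝒱 if Υ = −1, and (c_k)^{1/k} → ∞ if Υ < −1. -/
open scoped BigOperators
open Filter

/-- Stirling's formula for `log n!` with a logarithmic error term. -/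
theorem abs_log_factorial_sub_le {n : ℕ} (hn : n ≠ 0) :
    |Real.log (n.factorial : ℝ) - (n * Real.log n - n)| ≤ 1 + Real.log n := by
  have hn1 : (1 : ℝ) ≤ n := by exact_mod_cast Nat.one_le_iff_ne_zero.mpr hn
  have hlog : 0 ≤ Real.log n := Real.log_nonneg hn1
  have hpi : 0 ≤ Real.log (2 * Real.pi) :=
    Real.log_nonneg (by linarith [Real.pi_gt_three])
  have hlow := Stirling.le_log_factorial_stirling hn
  have hup : Real.log (Stirling.stirlingSeq n) ≤ Real.log (Stirling.stirlingSeq 1) := by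
    obtain ⟨m, rfl⟩ := Nat.exists_eq_succ_of_ne_zero hn
    exact Stirling.log_stirlingSeq'_antitone (Nat.zero_le m)
  rw [Stirling.log_stirlingSeq_formula, Stirling.log_stirlingSeq_formula,
    Real.log_div (by positivity) (by positivity), Real.log_exp,
    Real.log_mul (by norm_num) (by positivity)] at hup
  norm_num at hup
  rw [abs_le]
  constructor <;> linarith

/-- Stirling's formula for `log Γ(x)` with a logarithmic error term. -/
theorem abs_log_Gamma_sub_le {x : ℝ} (hx : 2 ≤ x) :
    |Real.log (Real.Gamma x) - (x * Real.log x - x)| ≤ 1 + 3 * Real.log x := by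
  obtain ⟨n, hnx, hxn⟩ : ∃ n : ℕ, (n : ℝ) ≤ x ∧ x < n + 1 :=
    ⟨⌊x⌋₊, Nat.floor_le (by linarith), Nat.lt_floor_add_one x⟩
  have hn2 : 2 ≤ n := by
    have : (1 : ℝ) < n := by linarith
    exact_mod_cast this
  have hn2' : (2 : ℝ) ≤ n := by exact_mod_cast hn2
  have hfac : Real.Gamma (n + 1) = n * Real.Gamma n := Real.Gamma_add_one (by positivity)
  have hGn : 0 < Real.Gamma n := Real.Gamma_pos_of_pos (by positivity)
  have hGx : 0 < Real.Gamma x := Real.Gamma_pos_of_pos (by linarith)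
  have hmono := Real.Gamma_strictMonoOn_Ici.monotoneOn
  have h1 : Real.log (Real.Gamma n) ≤ Real.log (Real.Gamma x) :=
    Real.log_le_log hGn (hmono hn2' hx hnx)
  have h2 : Real.log (Real.Gamma x) ≤ Real.log (Real.Gamma (n + 1)) :=
    Real.log_le_log hGx
      (hmono hx (Set.mem_Ici.mpr (by linarith)) hxn.le)
  have h3 : Real.log (Real.Gamma (n + 1)) = Real.log n + Real.log (Real.Gamma n) := by
    rw [hfac, Real.log_mul (by positivity) hGn.ne']
  have h4 := abs_le.mp (abs_log_factorial_sub_le (n := n) (by lia))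
  rw [← Real.Gamma_nat_eq_factorial] at h4
  have hlog : Real.log n ≤ Real.log x := Real.log_le_log (by linarith) hnx
  have hlogn : 0 ≤ Real.log n := Real.log_nonneg (by linarith)
  have hx0 : 0 < x := by linarith
  have hn0 : (0 : ℝ) < n := by linarith
  have h5 : x * (Real.log x - Real.log n) ≥ x - n := by
    have h := Real.one_sub_inv_le_log_of_pos (x := x / n) (by positivity)
    rw [Real.log_div hx0.ne' hn0.ne', inv_div] at h
    have := mul_le_mul_of_nonneg_left h hx0.le
    have e : x * (1 - n / x) = x - n := by field_simp
    linarith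
  have h6 : n * (Real.log x - Real.log n) ≤ x - n := by
    have h := Real.log_le_sub_one_of_pos (x := x / n) (by positivity)
    rw [Real.log_div hx0.ne' hn0.ne'] at h
    have := mul_le_mul_of_nonneg_left h hn0.le
    have e : n * (x / n - 1) = x - n := by field_simp
    linarith
  have h7 : 0 ≤ (x - n) * Real.log n := mul_nonneg (by linarith) hlogn
  have h8 : (x - n) * Real.log x ≤ Real.log x :=
    mul_le_of_le_one_left (by linarith) (by linarith)
  rw [abs_le]
  constructor <;> nlinarith

theorem tendsto_log_natCast_div : Tendsto (fun k : ℕ => Real.log k / k) atTop (nhds 0) :=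
  Real.isLittleO_log_id_atTop.tendsto_div_nhds_zero.comp tendsto_natCast_atTop_atTop

theorem tendsto_log_Gamma_div_sub {a A : ℝ} (hA : 0 < A) :
    Tendsto (fun k : ℕ => Real.log (Real.Gamma (a + k * A)) / k - A * Real.log k)
      atTop (nhds (A * Real.log A - A)) := by
  have hinv : Tendsto (fun k : ℕ => (k : ℝ)⁻¹) atTop (nhds 0) :=
    tendsto_inv_atTop_nhds_zero_nat
  have hlogdiv := tendsto_log_natCast_div
  have hx : Tendsto (fun k : ℕ => a + (k : ℝ) * A) atTop atTop :=
    tendsto_atTop_add_const_left _ _ (tendsto_natCast_atTop_atTop.atTop_mul_const hA)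
  have hr : Tendsto (fun k : ℕ => a * (k : ℝ)⁻¹ + A) atTop (nhds A) := by
    simpa using (hinv.const_mul a).add_const A
  have hlogr := (Real.continuousAt_log hA.ne').tendsto.comp hr
  have hmain : Tendsto (fun k : ℕ => (a * (k : ℝ)⁻¹ + A) * Real.log (a * (k : ℝ)⁻¹ + A)
      + a * (Real.log k / k) - (a * (k : ℝ)⁻¹ + A)) atTop (nhds (A * Real.log A - A)) := by
    simpa using ((hr.mul hlogr).add (hlogdiv.const_mul a)).sub hr
  have herr : Tendsto (fun k : ℕ => (k : ℝ)⁻¹ +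
      3 * (Real.log (a * (k : ℝ)⁻¹ + A) * (k : ℝ)⁻¹ + Real.log k / k)) atTop (nhds 0) := by
    simpa using hinv.add (((hlogr.mul hinv).add hlogdiv).const_mul 3)
  have hdiff := squeeze_zero_norm' (f := fun k : ℕ =>
    (Real.log (Real.Gamma (a + k * A)) / k - A * Real.log k) -
      ((a * (k : ℝ)⁻¹ + A) * Real.log (a * (k : ℝ)⁻¹ + A)
        + a * (Real.log k / k) - (a * (k : ℝ)⁻¹ + A))) ?_ herr
  · simpa using hdiff.add hmain
  · filter_upwards [hx.eventually_ge_atTop 2, eventually_gt_atTop 0] with k hk hk0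
    have hk0' : (0 : ℝ) < k := by exact_mod_cast hk0
    have hxk : a + k * A = k * (a * (k : ℝ)⁻¹ + A) := by field_simp
    have hrpos : 0 < a * (k : ℝ)⁻¹ + A :=
      pos_of_mul_pos_right (hxk ▸ (by linarith : 0 < a + k * A)) hk0'.le
    have hlogx : Real.log (a + k * A) = Real.log k + Real.log (a * (k : ℝ)⁻¹ + A) := by
      rw [hxk, Real.log_mul hk0'.ne' hrpos.ne']
    have hG := div_le_div_of_nonneg_right (abs_log_Gamma_sub_le hk) hk0'.le
    rw [← abs_of_pos hk0', ← abs_div, abs_of_pos hk0', hlogx] at hG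
    rw [Real.norm_eq_abs]
    generalize Real.log (a * (k : ℝ)⁻¹ + A) = L at hG ⊢
    refine (congrArg abs ?_).trans_le (hG.trans_eq ?_)
    · field_simp
      ring
    · field_simp
      ring

/-- lim_{k→∞} k^{Υ+1}·(c_k)^{1/k} = e^{Υ+1}/𝒱, with c_k > 0 for
all k.  In particular (c_k)^{1/k} → 0 if Υ > −1, (c_k)^{1/k} → 1/𝒱 if Υ = −1,
and (c_k)^{1/k} → ∞ if Υ < −1. -/
theorem foxWright_coeff_root_asymptotics
    (p q : ℕ) (a A : Fin p → ℝ) (b B : Fin q → ℝ)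
    (ha : ∀ l, 0 < a l) (hb : ∀ r, 0 < b r)
    (hA : ∀ l, 0 < A l) (hB : ∀ r, 0 < B r)
    (c : ℕ → ℝ)
    (hc : ∀ k : ℕ, c k =
      (∏ l, Real.Gamma (a l + (k : ℝ) * A l)) /
        ((∏ r, Real.Gamma (b r + (k : ℝ) * B r)) * (Nat.factorial k : ℝ)))
    (Υ : ℝ) (hΥ : Υ = (∑ r, B r) - (∑ l, A l))
    (𝒱 : ℝ)
    (h𝒱 : 𝒱 = (∏ r, (B r) ^ (B r)) * (∏ l, (A l) ^ (-(A l)))) :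
    (∀ k, 0 < c k) ∧
    Tendsto (fun k : ℕ => (k : ℝ) ^ (Υ + 1) * (c k) ^ (1 / (k : ℝ)))
      atTop (nhds (Real.exp (Υ + 1) / 𝒱)) ∧
    (-1 < Υ → Tendsto (fun k : ℕ => (c k) ^ (1 / (k : ℝ))) atTop (nhds 0)) ∧
    (Υ = -1 → Tendsto (fun k : ℕ => (c k) ^ (1 / (k : ℝ))) atTop (nhds (1 / 𝒱))) ∧
    (Υ < -1 → Tendsto (fun k : ℕ => (c k) ^ (1 / (k : ℝ))) atTop atTop) := by
  have hGa : ∀ (k : ℕ) l, 0 < Real.Gamma (a l + (k : ℝ) * A l) := fun k l =>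
    Real.Gamma_pos_of_pos (add_pos_of_pos_of_nonneg (ha l) (mul_nonneg k.cast_nonneg (hA l).le))
  have hGb : ∀ (k : ℕ) r, 0 < Real.Gamma (b r + (k : ℝ) * B r) := fun k r =>
    Real.Gamma_pos_of_pos (add_pos_of_pos_of_nonneg (hb r) (mul_nonneg k.cast_nonneg (hB r).le))
  have hfac : ∀ k : ℕ, (0 : ℝ) < k.factorial := fun k => by positivity
  have hpa := fun k : ℕ => Finset.prod_pos fun l (_ : l ∈ Finset.univ) => hGa k l
  have hpb := fun k : ℕ => Finset.prod_pos fun r (_ : r ∈ Finset.univ) => hGb k r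
  have hcpos : ∀ k, 0 < c k := fun k => by
    rw [hc]
    exact div_pos (hpa k) (mul_pos (hpb k) (hfac k))
  have hAA : ∀ l, 0 < A l ^ (-A l) := fun l => Real.rpow_pos_of_pos (hA l) _
  have hBB : ∀ r, 0 < B r ^ B r := fun r => Real.rpow_pos_of_pos (hB r) _
  have hpA := Finset.prod_pos fun l (_ : l ∈ Finset.univ) => hAA l
  have hpB := Finset.prod_pos fun r (_ : r ∈ Finset.univ) => hBB r
  have hV : 0 < 𝒱 := h𝒱 ▸ mul_pos hpB hpA
  have hlogV : Real.log 𝒱 = ∑ r, B r * Real.log (B r) - ∑ l, A l * Real.log (A l) := by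
    rw [h𝒱, Real.log_mul hpB.ne' hpA.ne', Real.log_prod fun r _ => (hBB r).ne',
      Real.log_prod fun l _ => (hAA l).ne']
    simp_rw [Real.log_rpow (hA _), Real.log_rpow (hB _), neg_mul, Finset.sum_neg_distrib]
    ring
  have hlogc : ∀ k, Real.log (c k) = ∑ l, Real.log (Real.Gamma (a l + (k : ℝ) * A l)) -
      ∑ r, Real.log (Real.Gamma (b r + (k : ℝ) * B r)) -
      Real.log (Real.Gamma (1 + (k : ℝ) * 1)) := fun k => by
    rw [hc, Real.log_div (hpa k).ne' (mul_pos (hpb k) (hfac k)).ne',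
      Real.log_mul (hpb k).ne' (hfac k).ne', Real.log_prod fun l _ => (hGa k l).ne',
      Real.log_prod fun r _ => (hGb k r).ne', mul_one, add_comm (1 : ℝ),
      Real.Gamma_nat_eq_factorial]
    ring
  have hlim : Tendsto (fun k : ℕ => (Υ + 1) * Real.log k + Real.log (c k) / k) atTop
      (nhds (Υ + 1 - Real.log 𝒱)) := by
    have h := ((tendsto_finsetSum Finset.univ fun l _ =>
      tendsto_log_Gamma_div_sub (a := a l) (hA l)).sub
      (tendsto_finsetSum Finset.univ fun r _ =>
        tendsto_log_Gamma_div_sub (a := b r) (hB r))).sub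
      (tendsto_log_Gamma_div_sub (a := 1) one_pos)
    convert h using 1
    · funext k
      simp_rw [hlogc, Finset.sum_sub_distrib, ← Finset.sum_mul, ← Finset.sum_div, hΥ]
      ring
    · simp_rw [hlogV, Finset.sum_sub_distrib, hΥ, Real.log_one]
      ring_nf
  have hmain : Tendsto (fun k : ℕ => (k : ℝ) ^ (Υ + 1) * (c k) ^ (1 / (k : ℝ)))
      atTop (nhds (Real.exp (Υ + 1) / 𝒱)) := by
    have h := (Real.continuous_exp.tendsto _).comp hlim
    rw [Real.exp_sub, Real.exp_log hV] at h
    refine h.congr' ?_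
    filter_upwards [eventually_gt_atTop 0] with k hk
    rw [Function.comp_apply, Real.exp_add, Real.rpow_def_of_pos (by exact_mod_cast hk),
      Real.rpow_def_of_pos (hcpos k), mul_comm (Υ + 1), mul_one_div]
  have hroot : (fun k : ℕ => (k : ℝ) ^ (-(Υ + 1)) *
      ((k : ℝ) ^ (Υ + 1) * (c k) ^ (1 / (k : ℝ)))) =ᶠ[atTop]
      fun k : ℕ => (c k) ^ (1 / (k : ℝ)) := by
    filter_upwards [eventually_gt_atTop 0] with k hk
    have hk' : (0 : ℝ) < k := by exact_mod_cast hk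
    rw [← mul_assoc, ← Real.rpow_add hk', neg_add_cancel, Real.rpow_zero, one_mul]
  refine ⟨hcpos, hmain, fun h => ?_, fun h => ?_, fun h => ?_⟩
  · have hk := (tendsto_rpow_neg_atTop (by linarith : 0 < Υ + 1)).comp
      (tendsto_natCast_atTop_atTop (R := ℝ))
    simpa using (hk.mul hmain).congr' hroot
  · simpa [h] using hmain
  · have hk := (tendsto_rpow_atTop (by linarith : 0 < -(Υ + 1))).comp
      (tendsto_natCast_atTop_atTop (R := ℝ))
    exact (hk.atTop_mul_pos (by positivity) hmain).congr' hroot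
end
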